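/- arXiv:1508.00867 — 2 statements merged into one kernel-verified Lean document; each statement's English description precedes it below -/
import Mathlib

section
/- If the G-stochastic function P_(·) has more than one closed intercommunicating class, then the set 𝒢(p) of probability measures compatible with the imitation kernel p contains at least two distinct elements. -/
open MeasureTheory
open scoped BigOperators

/-- The matrix of a word `𝐚 = (a_1, …, a_n)` (encoded as a list `[a_1, …, a_n]`),
namely `P_𝐚 = P_(a_n) ⋯ P_(a_1)`, so that `wordK P l i j` is the `(i,j)` entry. -/
noncomputable def wordK {G : Type*} [Fintype G] [DecidableEq G]
    (P : ℕ → G → G → ℝ) : List ℕ → G → G → ℝ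
  | [] => fun i j => if i = j then 1 else 0
  | a :: l => fun i j => ∑ m, wordK P l i m * P a m j

/-- A word over the alphabet `A`: a nonempty finite tuple with entries in `A`. -/
def IsWord (A : Set ℕ) (l : List ℕ) : Prop := l ≠ [] ∧ ∀ a ∈ l, a ∈ A

/-- `i` communicates with `j` if `P_𝐚(i,j) > 0` for some word `𝐚`. -/
def Communicates {G : Type*} [Fintype G] [DecidableEq G]
    (A : Set ℕ) (P : ℕ → G → G → ℝ) (i j : G) : Prop :=
  ∃ l : List ℕ, IsWord A l ∧ 0 < wordK P l i j

/-- `i` and `j` intercommunicate (every state intercommunicates with itself). -/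
def Intercommunicates {G : Type*} [Fintype G] [DecidableEq G]
    (A : Set ℕ) (P : ℕ → G → G → ℝ) (i j : G) : Prop :=
  i = j ∨ (Communicates A P i j ∧ Communicates A P j i)

/-- An intercommunicating class: an equivalence class of the intercommunication relation. -/
def IsInterClass {G : Type*} [Fintype G] [DecidableEq G]
    (A : Set ℕ) (P : ℕ → G → G → ℝ) (C : Set G) : Prop :=
  ∃ i : G, C = {j | Intercommunicates A P i j}

/-- A set `C` is closed if whenever `i ∈ C` communicates with `j`, then `j ∈ C`. -/
def IsClosedClass {G : Type*} [Fintype G] [DecidableEq G]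
    (A : Set ℕ) (P : ℕ → G → G → ℝ) (C : Set G) : Prop :=
  ∀ i ∈ C, ∀ j : G, Communicates A P i j → j ∈ C

/-- `d` is the greatest common divisor of the set `S ⊆ ℕ`. -/
def IsGCDOfSet (S : Set ℕ) (d : ℕ) : Prop :=
  (∀ n ∈ S, d ∣ n) ∧ ∀ e : ℕ, (∀ n ∈ S, e ∣ n) → e ∣ d

/-- The set of depths `s(𝐚)` of words `𝐚` with `P_𝐚(i,i) > 0`. -/
def ReturnDepths {G : Type*} [Fintype G] [DecidableEq G]
    (A : Set ℕ) (P : ℕ → G → G → ℝ) (i : G) : Set ℕ :=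
  {s | ∃ l : List ℕ, IsWord A l ∧ 0 < wordK P l i i ∧ l.sum = s}

/-- `E` is measurable with respect to the coordinates `(x_m)_{m < n}`. -/
def PastMeasurable {G : Type*} [MeasurableSpace G] (n : ℤ) (E : Set (ℤ → G)) : Prop :=
  MeasurableSet[MeasurableSpace.comap
    (fun x : ℤ → G => fun m : {m : ℤ // m < n} => x m.1) MeasurableSpace.pi] E

/-- `μ` is compatible with the imitation kernel
`p(g | w_{-1}, w_{-2}, …) = ∑_{k ∈ A} θ_k P_(k)(w_{-k}, g)` (here `θ` vanishes off `A`). -/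
def Compatible {G : Type*} [MeasurableSpace G] (θ : ℕ → ℝ) (P : ℕ → G → G → ℝ)
    (μ : Measure (ℤ → G)) : Prop :=
  ∀ (n : ℤ) (g : G) (E : Set (ℤ → G)), PastMeasurable n E →
    (μ (E ∩ {x | x n = g})).toReal
      = ∫ x in E, (∑' k : ℕ, θ k * P k (x (n - (k : ℤ))) g) ∂μ

/-- A sequence of normalized positive functionals on `C(X, ℝ)` has, along an ultrafilter, a limit
which is the integral against a probability measure. -/
theorem exists_measure_tendsto_functional {X : Type*} [TopologicalSpace X] [CompactSpace X]
    [T2Space X] [MeasurableSpace X] [BorelSpace X] (L : ℕ → C(X, ℝ) →ₗ[ℝ] ℝ)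
    (hpos : ∀ N f, 0 ≤ f → 0 ≤ L N f) (hone : ∀ N, L N 1 = 1) :
    ∃ (μ : Measure X) (U : Ultrafilter ℕ), IsProbabilityMeasure μ ∧ (U : Filter ℕ) ≤ Filter.atTop ∧
      ∀ f : C(X, ℝ), Filter.Tendsto (fun N => L N f) U (nhds (∫ x, f x ∂μ)) := by
  have hmono : ∀ N (f g : C(X, ℝ)), f ≤ g → L N f ≤ L N g := by
    intro N f g hfg
    have h := hpos N (g - f) (sub_nonneg.2 hfg)
    rw [map_sub] at h
    linarith
  have hbound : ∀ N f, L N f ∈ Set.Icc (-‖f‖) ‖f‖ := by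
    intro N f
    have key : ∀ c : ℝ, L N (c • 1) = c := fun c => by simp [hone]
    constructor
    · rw [← key (-‖f‖)]
      refine hmono N _ _ fun x => ?_
      simpa using (abs_le.1 (f.norm_coe_le_norm x)).1
    · rw [← key ‖f‖]
      refine hmono N _ _ fun x => ?_
      simpa using (abs_le.1 (f.norm_coe_le_norm x)).2
  let U : Ultrafilter ℕ := Ultrafilter.of Filter.atTop
  have hU : (U : Filter ℕ) ≤ Filter.atTop := Ultrafilter.of_le _
  have hlim : ∀ f, ∃ a, Filter.Tendsto (fun N => L N f) U (nhds a) := by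
    intro f
    obtain ⟨a, -, ha⟩ := (isCompact_Icc (a := -‖f‖) (b := ‖f‖)).ultrafilter_le_nhds
      (U.map fun N => L N f) (by
        rw [Filter.le_principal_iff]
        exact Filter.mem_map.2 (Filter.univ_mem' (hbound · f)))
    exact ⟨a, ha⟩
  choose Λ hΛ using hlim
  let Λc : CompactlySupportedContinuousMap X ℝ →ₗ[ℝ] ℝ :=
    { toFun := fun f => Λ f.toContinuousMap
      map_add' := fun f g => tendsto_nhds_unique (hΛ _) <| by
        have h := (hΛ f.toContinuousMap).add (hΛ g.toContinuousMap)
        simp only [← map_add] at h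
        exact h
      map_smul' := fun c f => tendsto_nhds_unique (hΛ _) <| by
        have h := (hΛ f.toContinuousMap).const_mul c
        simp only [← smul_eq_mul, ← map_smul] at h
        exact h }
  let Λp : CompactlySupportedContinuousMap X ℝ →ₚ[ℝ] ℝ := PositiveLinearMap.mk₀ Λc fun f hf =>
    ge_of_tendsto' (hΛ f.toContinuousMap) fun N => hpos N _ fun x => hf x
  have hint : ∀ f : C(X, ℝ), ∫ x, f x ∂(RealRMK.rieszMeasure Λp) = Λ f := fun f =>
    RealRMK.integral_rieszMeasure Λp (CompactlySupportedContinuousMap.continuousMapEquiv f)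
  refine ⟨RealRMK.rieszMeasure Λp, U, ?_, hU, fun f => (hint f).symm ▸ hΛ f⟩
  have h1 : Λ 1 = 1 := tendsto_nhds_unique (hΛ 1) (by simp [hone])
  have h := hint 1
  rw [h1] at h
  simp only [ContinuousMap.one_apply, integral_const, smul_eq_mul, mul_one] at h
  exact ⟨by rwa [measureReal_def, ENNReal.toReal_eq_one_iff] at h⟩

section Resampling

variable {G : Type*} [Fintype G] [TopologicalSpace G]

/-- A family of continuous transition functions: `q n g x` is the probability that coordinate `n`
takes the value `g`, given the coordinates `x m` with `m < n`. -/
structure IsPastKernel (q : ℤ → G → C(ℤ → G, ℝ)) : Prop where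
  nonneg : ∀ n g x, 0 ≤ q n g x
  sum_eq_one : ∀ n x, ∑ g, q n g x = 1
  dependsOn : ∀ n g, DependsOn (q n g) (Set.Iio n)

/-- The operator which averages a function over a resampling of the coordinate `n`. -/
noncomputable def resample (q : ℤ → G → C(ℤ → G, ℝ)) (n : ℤ) : C(ℤ → G, ℝ) →ₗ[ℝ] C(ℤ → G, ℝ) where
  toFun f := ∑ g, q n g * f.comp ⟨fun x => Function.update x n g, by fun_prop⟩
  map_add' f₁ f₂ := by
    ext x
    simp [mul_add, Finset.sum_add_distrib]
  map_smul' c f := by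
    ext x
    simp [Finset.mul_sum]

theorem resample_apply (q : ℤ → G → C(ℤ → G, ℝ)) (n : ℤ) (f : C(ℤ → G, ℝ)) (x : ℤ → G) :
    resample q n f x = ∑ g, q n g x * f (Function.update x n g) := by
  simp [resample]

/-- Average over the successive resampling of the coordinates `a, …, a + m - 1`. -/
noncomputable def resampleIter (q : ℤ → G → C(ℤ → G, ℝ)) (a : ℤ) :
    ℕ → C(ℤ → G, ℝ) →ₗ[ℝ] C(ℤ → G, ℝ)
  | 0 => LinearMap.id
  | m + 1 => resampleIter q a m ∘ₗ resample q (a + m)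

theorem IsPastKernel.resample_nonneg {q : ℤ → G → C(ℤ → G, ℝ)} (hq : IsPastKernel q) (n : ℤ)
    {f : C(ℤ → G, ℝ)} (hf : 0 ≤ f) : 0 ≤ resample q n f := by
  refine ContinuousMap.le_def.2 fun x => ?_
  rw [resample_apply]
  exact Finset.sum_nonneg fun g _ => mul_nonneg (hq.nonneg n g x) (hf _)

theorem IsPastKernel.resampleIter_nonneg {q : ℤ → G → C(ℤ → G, ℝ)} (hq : IsPastKernel q) (a : ℤ)
    (m : ℕ) {f : C(ℤ → G, ℝ)} (hf : 0 ≤ f) : 0 ≤ resampleIter q a m f := by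
  induction m generalizing f with
  | zero => exact hf
  | succ m ih => exact ih (hq.resample_nonneg _ hf)

/-- If a transition never leaves `S`, resampling preserves the vanishing on `S`-valued
configurations. -/
theorem resampleIter_eq_zero {q : ℤ → G → C(ℤ → G, ℝ)} {S : Set G}
    (hS : ∀ n g x, (∀ i, x i ∈ S) → q n g x ≠ 0 → g ∈ S) (a : ℤ) (m : ℕ) {f : C(ℤ → G, ℝ)}
    (hf : ∀ x, (∀ i, x i ∈ S) → f x = 0) {x : ℤ → G} (hx : ∀ i, x i ∈ S) :
    resampleIter q a m f x = 0 := by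
  induction m generalizing f with
  | zero => exact hf x hx
  | succ m ih =>
    refine ih fun y hy => ?_
    rw [resample_apply]
    refine Finset.sum_eq_zero fun g _ => ?_
    by_cases hg : q (a + m) g y = 0
    · rw [hg, zero_mul]
    · rw [hf _ fun i => ?_, mul_zero]
      rcases eq_or_ne i (a + m) with rfl | hi
      · simpa using hS _ g y hy hg
      · simpa [Function.update_of_ne hi] using hy i

variable [DiscreteTopology G]

/-- A function of the coordinate `n`, as a continuous function of the configuration. -/
def coordFun (n : ℤ) (φ : G → ℝ) : C(ℤ → G, ℝ) :=
  ⟨fun x => φ (x n), (continuous_of_discreteTopology (f := φ)).comp (continuous_apply n)⟩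

/-- Resampling the coordinate `n` fixes the functions of the coordinates before `n`, and turns the
indicator of a value at `n` into the corresponding transition function. -/
theorem resample_mul_coordFun (q : ℤ → G → C(ℤ → G, ℝ)) (n : ℤ) {f : C(ℤ → G, ℝ)}
    (hf : DependsOn f (Set.Iio n)) (φ : G → ℝ) :
    resample q n (f * coordFun n φ) = f * ∑ g, φ g • q n g := by
  ext x
  have hupd : ∀ g, f (Function.update x n g) = f x := fun g =>
    hf fun i hi => Function.update_of_ne (ne_of_lt hi) _ _
  simp [resample_apply, coordFun, hupd, Finset.mul_sum, mul_comm, mul_left_comm]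

namespace IsPastKernel

variable {q : ℤ → G → C(ℤ → G, ℝ)}

theorem resample_of_dependsOn (hq : IsPastKernel q) (n : ℤ) {f : C(ℤ → G, ℝ)}
    (hf : DependsOn f (Set.Iio n)) : resample q n f = f := by
  have h := resample_mul_coordFun q n hf 1
  have h1 : coordFun n (1 : G → ℝ) = 1 := rfl
  have h2 : ∑ g, (1 : G → ℝ) g • q n g = 1 := by
    ext x
    simp [hq.sum_eq_one]
  rwa [h1, h2, mul_one] at h

theorem resampleIter_one (hq : IsPastKernel q) (a : ℤ) (m : ℕ) : resampleIter q a m 1 = 1 := by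
  induction m with
  | zero => rfl
  | succ m ih =>
    have h : resample q (a + m) 1 = 1 := hq.resample_of_dependsOn _ fun _ _ _ => rfl
    simp [resampleIter, h, ih]

theorem resampleIter_mul_coordFun (hq : IsPastKernel q) [DecidableEq G] {a n : ℤ} (han : a ≤ n)
    {m : ℕ} (hnm : n < a + m) {f : C(ℤ → G, ℝ)} (hf : DependsOn f (Set.Iio n)) (g : G) :
    resampleIter q a m (f * coordFun n (Pi.single g 1)) = resampleIter q a m (f * q n g) := by
  induction m with
  | zero => simp at hnm; omega
  | succ m ih =>
    have hfq : DependsOn (f * q n g) (Set.Iio n) := fun x y h => by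
      simp [hf h, hq.dependsOn n g h]
    rcases eq_or_ne n (a + m) with rfl | hne
    · simp only [resampleIter, LinearMap.comp_apply]
      rw [resample_mul_coordFun q _ hf, hq.resample_of_dependsOn _ hfq]
      simp [Pi.single_apply]
    · have hlt : n < a + m := by push_cast at hnm; omega
      have hsub : Set.Iio n ⊆ Set.Iio (a + (m : ℤ)) := Set.Iio_subset_Iio hlt.le
      have hfc : DependsOn (f * coordFun n (Pi.single g 1)) (Set.Iio (a + (m : ℤ))) :=
        fun x y h => by
          simp [hf fun i hi => h i (hsub hi), coordFun, h n hlt]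
      simp only [resampleIter, LinearMap.comp_apply]
      rw [hq.resample_of_dependsOn _ hfc,
        hq.resample_of_dependsOn _ fun x y h => hfq fun i hi => h i (hsub hi), ih hlt]

/-- A past kernel which never leaves `S` has a compatible probability measure carried by `S`. -/
theorem exists_measure (hq : IsPastKernel q) [DecidableEq G] [MeasurableSpace G] [BorelSpace G]
    {S : Set G} (hne : S.Nonempty) (hS : ∀ n g x, (∀ i, x i ∈ S) → q n g x ≠ 0 → g ∈ S) :
    ∃ μ : Measure (ℤ → G), IsProbabilityMeasure μ ∧ μ {x | x 0 ∈ Sᶜ} = 0 ∧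
      ∀ (n : ℤ) (g : G) (f : C(ℤ → G, ℝ)), DependsOn f (Set.Iio n) →
        ∫ x, f x * (Pi.single g 1 : G → ℝ) (x n) ∂μ = ∫ x, f x * q n g x ∂μ := by
  obtain ⟨c, hc⟩ := hne
  let L : ℕ → C(ℤ → G, ℝ) →ₗ[ℝ] ℝ := fun N =>
    { toFun := fun f => resampleIter q (-N) (2 * N) f fun _ => c
      map_add' := fun f g => by simp
      map_smul' := fun r f => by simp }
  obtain ⟨μ, U, hμ, hU, hlim⟩ := exists_measure_tendsto_functional L
    (fun N f hf => hq.resampleIter_nonneg _ _ hf _)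
    (fun N => by simp [L, hq.resampleIter_one])
  refine ⟨μ, hμ, ?_, fun n g f hf => ?_⟩
  · have hzero : ∫ x, coordFun 0 (Sᶜ.indicator 1) x ∂μ = 0 := by
      refine tendsto_nhds_unique (hlim _) (tendsto_const_nhds.congr fun N => ?_)
      refine (resampleIter_eq_zero hS _ _ (fun x hx => ?_) fun _ => hc).symm
      simp [coordFun, hx 0]
    have hms : MeasurableSet {x : ℤ → G | x 0 ∈ Sᶜ} :=
      measurable_pi_apply 0 (Set.toFinite Sᶜ).measurableSet
    have hind : ⇑(coordFun 0 (Sᶜ.indicator 1) : C(ℤ → G, ℝ)) =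
        {x : ℤ → G | x 0 ∈ Sᶜ}.indicator 1 := rfl
    rw [hind, integral_indicator_one hms] at hzero
    exact (measureReal_eq_zero_iff).1 hzero
  · refine tendsto_nhds_unique (hlim (f * coordFun n (Pi.single g 1)))
      ((hlim (f * q n g)).congr' ?_)
    filter_upwards [hU (Filter.eventually_gt_atTop n.natAbs)] with N hN
    exact congrArg (fun h : C(ℤ → G, ℝ) => h fun _ => c)
      (hq.resampleIter_mul_coordFun (by omega) (by push_cast; omega) hf g).symm

end IsPastKernel

/-- Compatibility may be tested on continuous functions of the past. -/
theorem compatible_of_forall_integral_eq [DecidableEq G] [MeasurableSpace G] [BorelSpace G]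
    {μ : Measure (ℤ → G)} [IsFiniteMeasure μ] {n : ℤ} {g : G} {q : C(ℤ → G, ℝ)}
    (hq : ∀ x, 0 ≤ q x)
    (h : ∀ f : C(ℤ → G, ℝ), DependsOn f (Set.Iio n) →
      ∫ x, f x * (Pi.single g 1 : G → ℝ) (x n) ∂μ = ∫ x, f x * q x ∂μ)
    {E : Set (ℤ → G)} (hE : PastMeasurable n E) :
    (μ (E ∩ {x | x n = g})).toReal = ∫ x in E, q x ∂μ := by
  let π : (ℤ → G) → {m : ℤ // m < n} → G := fun x m => x m.1
  have hπc : Continuous π := by fun_prop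
  have hπ : Measurable π := hπc.measurable
  have hms : MeasurableSet {x : ℤ → G | x n = g} :=
    (measurable_pi_apply n : Measurable fun x : ℤ → G => x n) (measurableSet_singleton g)
  have hqi : Integrable q μ := q.continuous.integrable_of_hasCompactSupport
    (HasCompactSupport.of_compactSpace _)
  have : IsFiniteMeasure (μ.withDensity fun x => ENNReal.ofReal (q x)) :=
    isFiniteMeasure_withDensity_ofReal hqi.2
  have hEq : (μ.restrict {x | x n = g}).map π =
      (μ.withDensity fun x => ENNReal.ofReal (q x)).map π := by
    refine ext_of_forall_integral_eq_of_IsFiniteMeasure fun f => ?_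
    rw [integral_map hπ.aemeasurable f.continuous.aestronglyMeasurable,
      integral_map hπ.aemeasurable f.continuous.aestronglyMeasurable,
      integral_withDensity_eq_integral_toReal_smul
        q.continuous.measurable.ennreal_ofReal (by simp), ← integral_indicator hms]
    have hf := h ⟨fun x => f (π x), f.continuous.comp hπc⟩ fun x y hxy =>
      congrArg f (funext fun m => hxy m.1 m.2)
    convert hf using 3 with x x
    · by_cases hx : x n = g <;> simp [Set.indicator, hx]
    · rw [ENNReal.toReal_ofReal (hq x), smul_eq_mul, mul_comm]
      rfl
  obtain ⟨B, hB, rfl⟩ := hE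
  have hEB := congrArg (fun ν => ν B) hEq
  simp only [Measure.map_apply hπ hB] at hEB
  have hπB : MeasurableSet (π ⁻¹' B) := hπ hB
  rw [Measure.restrict_apply hπB, withDensity_apply _ hπB] at hEB
  rw [integral_eq_lintegral_of_nonneg_ae (Filter.Eventually.of_forall hq)
    q.continuous.aestronglyMeasurable]
  exact congrArg ENNReal.toReal hEB

end Resampling

/-- The imitation kernel has a compatible probability measure carried by any nonempty set of
states which is closed for the communication relation. -/
theorem exists_compatible_of_isClosedClass {G : Type*} [Fintype G] [DecidableEq G]
    [MeasurableSpace G] [MeasurableSingletonClass G]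
    {A : Set ℕ} (hApos : ∀ k ∈ A, 0 < k)
    {θ : ℕ → ℝ} (hθpos : ∀ k ∈ A, 0 < θ k) (hθ0 : ∀ k, k ∉ A → θ k = 0)
    (hθsum : HasSum θ 1) {P : ℕ → G → G → ℝ}
    (hPnn : ∀ k ∈ A, ∀ i j : G, 0 ≤ P k i j)
    (hProw : ∀ k ∈ A, ∀ i : G, ∑ j, P k i j = 1)
    {C : Set G} (hne : C.Nonempty) (hC : IsClosedClass A P C) :
    ∃ μ : Measure (ℤ → G), IsProbabilityMeasure μ ∧ Compatible θ P μ ∧ μ {x | x 0 ∈ Cᶜ} = 0 := by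
  let _ : TopologicalSpace G := ⊥
  have : DiscreteTopology G := ⟨rfl⟩
  have hP1 : ∀ k ∈ A, ∀ i j, P k i j ≤ 1 := fun k hk i j => by
    rw [← hProw k hk i]
    exact Finset.single_le_sum (fun j _ => hPnn k hk i j) (Finset.mem_univ j)
  have hnn : ∀ k i j, 0 ≤ θ k * P k i j := fun k i j => by
    by_cases hk : k ∈ A
    · exact mul_nonneg (hθpos k hk).le (hPnn k hk i j)
    · simp [hθ0 k hk]
  have hle : ∀ k i j, θ k * P k i j ≤ θ k := fun k i j => by
    by_cases hk : k ∈ A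
    · exact mul_le_of_le_one_right (hθpos k hk).le (hP1 k hk i j)
    · simp [hθ0 k hk]
  have hsummable : ∀ (n : ℤ) g (x : ℤ → G), Summable fun k : ℕ => θ k * P k (x (n - k)) g :=
    fun n g x => Summable.of_nonneg_of_le (fun k => hnn _ _ _) (fun k => hle _ _ _) hθsum.summable
  let q : ℤ → G → C(ℤ → G, ℝ) := fun n g =>
    ⟨fun x => ∑' k : ℕ, θ k * P k (x (n - (k : ℤ))) g,
      continuous_tsum (fun k => continuous_const.mul
        ((continuous_of_discreteTopology (f := fun i => P k i g)).comp (continuous_apply _)))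
        hθsum.summable fun k x => by
          rw [Real.norm_of_nonneg (hnn _ _ _)]
          exact hle _ _ _⟩
  have hq : IsPastKernel q :=
    { nonneg := fun n g x => tsum_nonneg fun k => hnn _ _ _
      sum_eq_one := fun n x => by
        change ∑ g, ∑' k : ℕ, θ k * P k (x (n - (k : ℤ))) g = 1
        rw [← Summable.tsum_finsetSum fun g _ => hsummable n g x, ← hθsum.tsum_eq]
        refine tsum_congr fun k => ?_
        rw [← Finset.mul_sum]
        by_cases hk : k ∈ A
        · rw [hProw k hk, mul_one]
        · simp [hθ0 k hk]
      dependsOn := fun n g x y hxy => tsum_congr fun k => by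
        by_cases hk : k ∈ A
        · have := hApos k hk
          rw [hxy (n - k) (by simp only [Set.mem_Iio]; omega)]
        · simp [hθ0 k hk] }
  obtain ⟨μ, hμ, hμC, hint⟩ := hq.exists_measure hne fun n g x hx hqx => by
    obtain ⟨k, hk⟩ : ∃ k : ℕ, θ k * P k (x (n - k)) g ≠ 0 := by
      by_contra! h
      exact hqx ((tsum_congr h).trans tsum_zero)
    have hkA : k ∈ A := by
      by_contra hkA
      simp [hθ0 k hkA] at hk
    refine hC _ (hx (n - k)) g ⟨[k], ⟨by simp, by simpa using hkA⟩, ?_⟩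
    simpa [wordK] using (hPnn k hkA _ _).lt_of_ne' (right_ne_zero_of_mul hk)
  exact ⟨μ, hμ, fun n g E hE => compatible_of_forall_integral_eq (hq.nonneg n g) (hint n g) hE, hμC⟩

/-- A closed intercommunicating class is contained in every closed set that it meets. -/
theorem IsInterClass.subset_of_mem {G : Type*} [Fintype G] [DecidableEq G] {A : Set ℕ}
    {P : ℕ → G → G → ℝ} {C D : Set G} (hC : IsInterClass A P C) (hD : IsClosedClass A P D)
    {x : G} (hxC : x ∈ C) (hxD : x ∈ D) : C ⊆ D := by
  obtain ⟨i, rfl⟩ := hC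
  have hi : i ∈ D := by
    rcases hxC with rfl | h
    · exact hxD
    · exact hD x hxD i h.2
  rintro y (rfl | h)
  · exact hi
  · exact hD i hi y h.1

/-- more than one closed intercommunicating class implies
`|𝒢(p)| > 1`. -/
theorem stmt_2 {G : Type*} [Fintype G] [DecidableEq G] [Nonempty G]
    [MeasurableSpace G] [MeasurableSingletonClass G]
    (A : Set ℕ) (hA : A.Nonempty) (hApos : ∀ k ∈ A, 0 < k)
    (θ : ℕ → ℝ) (hθpos : ∀ k ∈ A, 0 < θ k) (hθ0 : ∀ k, k ∉ A → θ k = 0)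
    (hθsum : HasSum θ 1)
    (P : ℕ → G → G → ℝ)
    (hPnn : ∀ k ∈ A, ∀ i j : G, 0 ≤ P k i j)
    (hProw : ∀ k ∈ A, ∀ i : G, ∑ j, P k i j = 1)
    (hmany : ∃ C₁ C₂ : Set G,
      IsInterClass A P C₁ ∧ IsClosedClass A P C₁ ∧
      IsInterClass A P C₂ ∧ IsClosedClass A P C₂ ∧ C₁ ≠ C₂) :
    ∃ μ ν : Measure (ℤ → G),
      IsProbabilityMeasure μ ∧ Compatible θ P μ ∧
      IsProbabilityMeasure ν ∧ Compatible θ P ν ∧ μ ≠ ν := by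
  obtain ⟨C₁, C₂, hI₁, hC₁, hI₂, hC₂, hne⟩ := hmany
  have hne₁ : C₁.Nonempty := hI₁.elim fun i h => ⟨i, h ▸ Or.inl rfl⟩
  have hne₂ : C₂.Nonempty := hI₂.elim fun i h => ⟨i, h ▸ Or.inl rfl⟩
  obtain ⟨μ, hμ, hcμ, hμ₁⟩ :=
    exists_compatible_of_isClosedClass hApos hθpos hθ0 hθsum hPnn hProw hne₁ hC₁
  obtain ⟨ν, hν, hcν, hν₂⟩ :=
    exists_compatible_of_isClosedClass hApos hθpos hθ0 hθsum hPnn hProw hne₂ hC₂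
  refine ⟨μ, ν, hμ, hcμ, hν, hcν, ?_⟩
  rintro rfl
  refine IsProbabilityMeasure.ne_zero μ (Measure.measure_univ_eq_zero.1 ?_)
  refine measure_mono_null (fun x _ => ?_) (measure_union_null hμ₁ hν₂)
  by_contra hx
  obtain ⟨h₁, h₂⟩ : x 0 ∈ C₁ ∧ x 0 ∈ C₂ := by simpa using hx
  exact hne ((hI₁.subset_of_mem hC₂ h₁ h₂).antisymm (hI₂.subset_of_mem hC₁ h₂ h₁))
end

section
/- Suppose d = gcd(A) > 1. Define Ā = {l ≥ 1 : l·d ∈ A}, θ̄_l = θ_{l·d} and P̄_(l) = P_(l·d) for l ∈ Ā, and let p̄ be the imitation kernel built from Ā, θ̄ and P̄_(·). Then 𝒢(p) has exactly one element if and only if 𝒢(p̄) has exactly one element. -/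
open MeasureTheory
open scoped BigOperators

section ImitationUniqueness

open ProbabilityTheory
open scoped ENNReal

/-- The σ-algebra on `ℤ → G` generated by the coordinates in `S`. -/
@[reducible]
def coordSigma (G : Type*) [MeasurableSpace G] (S : Set ℤ) : MeasurableSpace (ℤ → G) :=
  ⨆ i ∈ S, MeasurableSpace.comap (fun x => x i) inferInstance

/-- The set of configurations agreeing with `a` on the finite set `t`. -/
def finCylinder {G : Type*} (t : Finset ℤ) (a : ℤ → G) : Set (ℤ → G) :=
  {x | ∀ i ∈ t, x i = a i}

/-- The configuration read along the coordinates `φ`. -/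
def reindex (G : Type*) (φ : ℤ → ℤ) (x : ℤ → G) : ℤ → G := fun m => x (φ m)

/-- `μ` is compatible with the (`ℝ≥0∞`-valued) kernel `q`, where `q n g` is the conditional
probability of `x n = g` as a function of the whole configuration. -/
def LCompatible {G : Type*} [MeasurableSpace G] (q : ℤ → G → (ℤ → G) → ℝ≥0∞)
    (μ : Measure (ℤ → G)) : Prop :=
  ∀ (n : ℤ) (g : G) (E : Set (ℤ → G)), MeasurableSet[coordSigma G (Set.Iio n)] E →
    μ (E ∩ {x | x n = g}) = ∫⁻ x in E, q n g x ∂μ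

section CoordSigma

lemma isPiSystem_finCylinder {G : Type*} (S : Set ℤ) : IsPiSystem
    (insert ∅ {E : Set (ℤ → G) |
      ∃ (t : Finset ℤ) (a : ℤ → G), ↑t ⊆ S ∧ E = finCylinder t a}) := by
  apply IsPiSystem.insert_empty
  rintro _ ⟨t, a, ht, rfl⟩ _ ⟨s, b, hs, rfl⟩ ⟨x, hxa, hxb⟩
  refine ⟨t ∪ s, x, by simp [ht, hs], ?_⟩
  ext y
  simp only [finCylinder, Set.mem_inter_iff, Set.mem_ofPred_eq, Finset.mem_union] at *
  constructor
  · rintro ⟨h1, h2⟩ i (hi | hi)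
    · rw [h1 i hi, hxa i hi]
    · rw [h2 i hi, hxb i hi]
  · intro h
    exact ⟨fun i hi => by rw [h i (Or.inl hi), hxa i hi],
      fun i hi => by rw [h i (Or.inr hi), hxb i hi]⟩

variable {G : Type*} [MeasurableSpace G]

lemma coordSigma_mono {S T : Set ℤ} (h : S ⊆ T) : coordSigma G S ≤ coordSigma G T :=
  biSup_mono h

lemma coordSigma_le (S : Set ℤ) : coordSigma G S ≤ MeasurableSpace.pi :=
  iSup₂_le fun i _ => (measurable_pi_apply i).comap_le

lemma measurable_apply_coordSigma {S : Set ℤ} {i : ℤ} (hi : i ∈ S) :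
    Measurable[coordSigma G S] (fun x : ℤ → G => x i) :=
  measurable_iff_comap_le.2 (le_iSup₂_of_le i hi le_rfl)

lemma measurable_reindex_coordSigma {φ : ℤ → ℤ} {S T : Set ℤ} (h : ∀ m ∈ T, φ m ∈ S) :
    Measurable[coordSigma G S, coordSigma G T] (reindex G φ) := by
  rw [measurable_iff_comap_le]
  simp only [coordSigma, MeasurableSpace.comap_iSup, MeasurableSpace.comap_comp]
  exact iSup₂_le fun m hm => le_iSup₂_of_le (φ m) (h m hm) le_rfl

lemma measurable_reindex (φ : ℤ → ℤ) : Measurable (reindex G φ) :=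
  measurable_pi_lambda _ fun m => measurable_pi_apply (φ m)

lemma pastMeasurable_iff (n : ℤ) (E : Set (ℤ → G)) :
    PastMeasurable n E ↔ MeasurableSet[coordSigma G (Set.Iio n)] E := by
  have h : MeasurableSpace.comap (fun x : ℤ → G => fun m : {m : ℤ // m < n} => x m.1)
      MeasurableSpace.pi = coordSigma G (Set.Iio n) := by
    simp only [coordSigma, MeasurableSpace.pi, MeasurableSpace.comap_iSup,
      MeasurableSpace.comap_comp, iSup_subtype]
    rfl
  rw [PastMeasurable, h]

variable [MeasurableSingletonClass G]

lemma measurableSet_finCylinder {S : Set ℤ} {t : Finset ℤ} (ht : ↑t ⊆ S) (a : ℤ → G) :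
    MeasurableSet[coordSigma G S] (finCylinder t a) := by
  have h : finCylinder t a = ⋂ i ∈ t, (fun x : ℤ → G => x i) ⁻¹' {a i} := by
    ext x; simp [finCylinder]
  rw [h]
  exact Finset.measurableSet_biInter t fun i hi =>
    measurable_apply_coordSigma (ht hi) (measurableSet_singleton _)

variable [Finite G]

lemma coordSigma_eq_generateFrom (S : Set ℤ) :
    coordSigma G S = MeasurableSpace.generateFrom
      (insert ∅ {E | ∃ (t : Finset ℤ) (a : ℤ → G), ↑t ⊆ S ∧ E = finCylinder t a}) := by
  apply le_antisymm
  · refine iSup₂_le fun i hi => ?_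
    rw [← measurable_iff_comap_le]
    refine @measurable_to_countable' _ _ _ _ (MeasurableSpace.generateFrom _) _ fun g => ?_
    refine MeasurableSpace.measurableSet_generateFrom (Or.inr ⟨{i}, fun _ => g, ?_, ?_⟩)
    · simpa using hi
    · ext x; simp [finCylinder]
  · refine MeasurableSpace.generateFrom_le ?_
    rintro E (rfl | ⟨t, a, ht, rfl⟩)
    · exact @MeasurableSet.empty _ (coordSigma G S)
    · exact measurableSet_finCylinder ht a

lemma measure_eq_of_finCylinder [Nonempty G] {S : Set ℤ} {μ ν : Measure (ℤ → G)}
    [IsFiniteMeasure μ]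
    (h : ∀ (t : Finset ℤ) (a : ℤ → G), ↑t ⊆ S → μ (finCylinder t a) = ν (finCylinder t a))
    {E : Set (ℤ → G)} (hE : MeasurableSet[coordSigma G S] E) : μ E = ν E := by
  refine ext_on_measurableSpace_of_generate_finite MeasurableSpace.pi _ ?_ (coordSigma_le S)
    (coordSigma_eq_generateFrom S) (isPiSystem_finCylinder S) ?_ hE
  · rintro E (rfl | ⟨t, a, ht, rfl⟩)
    · simp
    · exact h t a ht
  · simpa [finCylinder] using h ∅ (fun _ => Classical.arbitrary G) (by simp)

end CoordSigma

lemma setLIntegral_congr_of_measure_eq {Ω : Type*} {m m0 : MeasurableSpace Ω} (hm : m ≤ m0)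
    {μ ν : Measure[m0] Ω} (h : ∀ E, MeasurableSet[m] E → μ E = ν E)
    {f : Ω → ℝ≥0∞} (hf : Measurable[m] f) {E : Set Ω} (hE : MeasurableSet[m] E) :
    ∫⁻ x in E, f x ∂μ = ∫⁻ x in E, f x ∂ν := by
  have ht : μ.trim hm = ν.trim hm := by
    refine @Measure.ext _ m _ _ fun s hs => ?_
    rw [trim_measurableSet_eq hm hs, trim_measurableSet_eq hm hs, h s hs]
  rw [← setLIntegral_trim hm hf hE, ← setLIntegral_trim hm hf hE, ht]

section Splitting

variable {G ι : Type*} (e : ℤ ≃ ℤ × ι)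

/-- The order-preserving enumeration of the fibre of `r`. -/
def fibreEmb (r : ι) (m : ℤ) : ℤ := e.symm (m, r)

/-- The kernel which evolves every fibre of `e` by the kernel `q`. -/
def splitKernel (q : ℤ → G → (ℤ → G) → ℝ≥0∞) : ℤ → G → (ℤ → G) → ℝ≥0∞ :=
  fun n g x => q (e n).1 g (reindex G (fibreEmb e (e n).2) x)

/-- Interleave a family of configurations along the fibres of `e`. -/
def weave (G : Type*) (e : ℤ ≃ ℤ × ι) (y : ι → ℤ → G) : ℤ → G := fun n => y (e n).2 (e n).1

variable {e}

lemma reindex_weave (r : ι) (y : ι → ℤ → G) : reindex G (fibreEmb e r) (weave G e y) = y r := by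
  ext m; simp [reindex, fibreEmb, weave]

lemma weave_reindex (x : ℤ → G) : weave G e (fun r => reindex G (fibreEmb e r) x) = x := by
  ext m; simp [reindex, fibreEmb, weave]

variable [MeasurableSpace G]

lemma measurable_weave : Measurable (weave G e) :=
  measurable_pi_lambda _ fun n => (measurable_pi_apply (e n).1).comp (measurable_pi_apply (e n).2)

variable {q : ℤ → G → (ℤ → G) → ℝ≥0∞}

lemma measurable_splitKernel_coordSigma (he : ∀ r, StrictMono (fibreEmb e r))
    (hq : ∀ m g, Measurable[coordSigma G (Set.Iio m)] (q m g)) (n : ℤ) (g : G) :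
    Measurable[coordSigma G {i | i < n ∧ (e i).2 = (e n).2}] (splitKernel e q n g) := by
  refine (hq _ _).comp (measurable_reindex_coordSigma fun m hm => ⟨?_, ?_⟩)
  · have := he (e n).2 (show m < (e n).1 from hm)
    simpa [fibreEmb] using this
  · simp [fibreEmb]

lemma measurable_splitKernel (he : ∀ r, StrictMono (fibreEmb e r))
    (hq : ∀ m g, Measurable[coordSigma G (Set.Iio m)] (q m g)) (n : ℤ) (g : G) :
    Measurable (splitKernel e q n g) :=
  (measurable_splitKernel_coordSigma he hq n g).mono (coordSigma_le _) le_rfl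

/-- Integrating against the event `x n = g` amounts to integrating against its conditional
probability. -/
lemma setLIntegral_inter_eq_mul {S : Set ℤ} {μ : Measure (ℤ → G)}
    {n : ℤ} {g : G} {f u : (ℤ → G) → ℝ≥0∞} (hf : Measurable f)
    (h : ∀ E, MeasurableSet[coordSigma G S] E → μ (E ∩ {x | x n = g}) = ∫⁻ x in E, f x ∂μ)
    (hu : Measurable[coordSigma G S] u) {E : Set (ℤ → G)}
    (hE : MeasurableSet[coordSigma G S] E) :
    ∫⁻ x in E ∩ {x | x n = g}, u x ∂μ = ∫⁻ x in E, f x * u x ∂μ := by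
  have hE' := coordSigma_le S E hE
  have hu' : Measurable u := hu.mono (coordSigma_le S) le_rfl
  have key := setLIntegral_congr_of_measure_eq (coordSigma_le S)
    (μ := μ.restrict {x | x n = g}) (ν := μ.withDensity f) (fun B hB => ?_) hu hE
  · rw [Measure.restrict_restrict hE'] at key
    rw [key, setLIntegral_withDensity_eq_setLIntegral_mul μ hf hu' hE']
    rfl
  · rw [Measure.restrict_apply (coordSigma_le S B hB),
      withDensity_apply _ (coordSigma_le S B hB), h B hB]

variable [MeasurableSingletonClass G]

lemma measurableSet_apply_eq (n : ℤ) (g : G) : MeasurableSet {x : ℤ → G | x n = g} :=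
  (measurable_pi_apply (X := fun _ : ℤ => G) n) (measurableSet_singleton g)

variable [Finite G] [Nonempty G]

/-- To have the conditional probability of `x n = g` given the coordinates in `S`, it suffices
to look at cylinders. -/
lemma measure_inter_eq_setLIntegral_of_finCylinder {S : Set ℤ} {μ : Measure (ℤ → G)}
    [IsFiniteMeasure μ] {n : ℤ} {g : G} {f : (ℤ → G) → ℝ≥0∞}
    (h : ∀ (t : Finset ℤ) (a : ℤ → G), ↑t ⊆ S →
      μ (finCylinder t a ∩ {x | x n = g}) = ∫⁻ x in finCylinder t a, f x ∂μ)
    {E : Set (ℤ → G)} (hE : MeasurableSet[coordSigma G S] E) :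
    μ (E ∩ {x | x n = g}) = ∫⁻ x in E, f x ∂μ := by
  have key := measure_eq_of_finCylinder (S := S) (μ := μ.restrict {x | x n = g})
    (ν := μ.withDensity f) (fun t a ht => ?_) hE
  · rwa [Measure.restrict_apply (coordSigma_le S E hE),
      withDensity_apply _ (coordSigma_le S E hE)] at key
  · have hc := coordSigma_le S _ (measurableSet_finCylinder ht a)
    rw [Measure.restrict_apply hc, withDensity_apply _ hc, h t a ht]

/-- Under a compatible measure, conditioning additionally on all the coordinates in the other
fibres does not change the conditional probabilities. -/
lemma LCompatible.measure_inter_eq (he : ∀ r, StrictMono (fibreEmb e r))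
    (hq : ∀ m g, Measurable[coordSigma G (Set.Iio m)] (q m g)) {μ : Measure (ℤ → G)}
    [IsFiniteMeasure μ] (hμ : LCompatible (splitKernel e q) μ) (n : ℤ) (g : G)
    {E : Set (ℤ → G)}
    (hE : MeasurableSet[coordSigma G {i | i < n ∨ (e i).2 ≠ (e n).2}] E) :
    μ (E ∩ {x | x n = g}) = ∫⁻ x in E, splitKernel e q n g x ∂μ := by
  have step : ∀ (k : ℕ) (t : Finset ℤ) (a : ℤ → G),
      (↑t : Set ℤ) ⊆ {i | i < n ∨ (i < n + k ∧ (e i).2 ≠ (e n).2)} →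
      μ (finCylinder t a ∩ {x | x n = g})
        = ∫⁻ x in finCylinder t a, splitKernel e q n g x ∂μ := by
    intro k
    induction k with
    | zero =>
      intro t a ht
      refine hμ n g _ (measurableSet_finCylinder (fun i hi => ?_) a)
      rcases ht hi with h | h
      · exact h
      · simpa using h.1
    | succ k ih =>
      intro t a ht
      by_cases hN : n + (k : ℤ) ∈ t
      swap
      · refine ih t a fun i hi => ?_
        have hne : i ≠ n + k := fun h => hN (h ▸ hi)
        rcases ht hi with h | ⟨h1, h2⟩
        · exact Or.inl h
        · refine Or.inr ⟨?_, h2⟩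
          push_cast at h1
          omega
      set N : ℤ := n + k with hNdef
      have hNne : (e N).2 ≠ (e n).2 := by
        rcases ht hN with h | h
        · have : N < n := h
          omega
        · exact h.2
      have hnN : n < N := by
        have : N ≠ n := fun h => hNne (by rw [h])
        omega
      have ht' : (↑(t.erase N) : Set ℤ) ⊆ {i | i < n ∨ (i < N ∧ (e i).2 ≠ (e n).2)} := by
        intro i hi
        obtain ⟨hne, hi⟩ := Finset.mem_erase.1 hi
        rcases ht hi with h | ⟨h1, h2⟩
        · exact Or.inl h
        · refine Or.inr ⟨?_, h2⟩
          push_cast at h1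
          omega
      set S : Set ℤ := {i | i < n ∨ (i < N ∧ (e i).2 ≠ (e n).2)} with hS
      set H := finCylinder (t.erase N) a with hH
      have hHS : MeasurableSet[coordSigma G S] H := measurableSet_finCylinder ht' a
      have hSN : S ⊆ Set.Iio N := by
        rintro i (h | h)
        · exact lt_trans h hnN
        · exact h.1
      have hsplit : finCylinder t a = H ∩ {x | x N = a N} := by
        ext x
        simp only [hH, finCylinder, Finset.mem_erase, Set.mem_inter_iff, Set.mem_ofPred_eq]
        constructor
        · exact fun h => ⟨fun i hi => h i hi.2, h N hN⟩
        · rintro ⟨h1, h2⟩ i hi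
          by_cases hiN : i = N
          · rw [hiN, h2]
          · exact h1 i ⟨hiN, hi⟩
      have hqn : Measurable[coordSigma G (Set.Iio N)] (splitKernel e q n g) :=
        (measurable_splitKernel_coordSigma he hq n g).mono
          (coordSigma_mono fun i hi => lt_trans hi.1 hnN) le_rfl
      have hqN : Measurable[coordSigma G S] (splitKernel e q N (a N)) :=
        (measurable_splitKernel_coordSigma he hq N (a N)).mono
          (coordSigma_mono fun i hi => Or.inr ⟨hi.1, by rw [hi.2]; exact hNne⟩) le_rfl
      have hHN : MeasurableSet[coordSigma G (Set.Iio N)] H := coordSigma_mono hSN _ hHS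
      have hgN : MeasurableSet[coordSigma G (Set.Iio N)] {x : ℤ → G | x n = g} :=
        measurable_apply_coordSigma (show n ∈ Set.Iio N from hnN) (measurableSet_singleton g)
      rw [hsplit, Set.inter_right_comm,
        hμ N (a N) _ (@MeasurableSet.inter _ (coordSigma G (Set.Iio N)) _ _ hHN hgN),
        setLIntegral_inter_eq_mul (measurable_splitKernel he hq n g)
          (fun B hB => measure_inter_eq_setLIntegral_of_finCylinder ih hB) hqN hHS,
        setLIntegral_inter_eq_mul (measurable_splitKernel he hq N (a N))
          (fun B hB => hμ N (a N) B hB) hqn hHN]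
      simp only [mul_comm]
  refine measure_inter_eq_setLIntegral_of_finCylinder (fun t a ht => ?_) hE
  obtain ⟨M, hM⟩ := t.bddAbove
  refine step (M - n + 1).toNat t a fun i hi => ?_
  rcases ht hi with h | h
  · exact Or.inl h
  · refine Or.inr ⟨?_, h⟩
    have := hM hi
    omega

/-- Conditioning a compatible measure on an event of the other fibres yields a compatible
measure on a given fibre. -/
lemma LCompatible.map_reindex_cond (he : ∀ r, StrictMono (fibreEmb e r))
    (hq : ∀ m g, Measurable[coordSigma G (Set.Iio m)] (q m g)) {μ : Measure (ℤ → G)}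
    [IsFiniteMeasure μ] (hμ : LCompatible (splitKernel e q) μ) (r : ι)
    {E : Set (ℤ → G)} (hE : MeasurableSet[coordSigma G {i | (e i).2 ≠ r}] E) :
    LCompatible q ((ProbabilityTheory.cond μ E).map (reindex G (fibreEmb e r))) := by
  intro m g B hB
  have hE' := coordSigma_le _ _ hE
  have hB' := coordSigma_le _ _ hB
  have hq' : Measurable (q m g) := (hq m g).mono (coordSigma_le _) le_rfl
  have hφ := measurable_reindex (G := G) (fibreEmb e r)
  rw [setLIntegral_map hB' hq' hφ, Measure.map_apply hφ (hB'.inter (measurableSet_apply_eq m g)),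
    ProbabilityTheory.cond, Measure.restrict_smul, lintegral_smul_measure, Measure.smul_apply,
    Measure.restrict_restrict (hφ hB'),
    Measure.restrict_apply (hφ (hB'.inter (measurableSet_apply_eq m g)))]
  congr 1
  have hn : (e (fibreEmb e r m)) = (m, r) := by simp [fibreEmb]
  have key := hμ.measure_inter_eq he hq (fibreEmb e r m) g
    (E := reindex G (fibreEmb e r) ⁻¹' B ∩ E) ?_
  · simp only [splitKernel, hn] at key
    rw [← key]
    congr 1
    ext x
    simp only [Set.mem_inter_iff, Set.mem_preimage, Set.mem_ofPred_eq, reindex]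
    tauto
  · rw [hn]
    refine @MeasurableSet.inter _ (coordSigma G _) _ _ ?_ (coordSigma_mono ?_ _ hE)
    · exact measurable_reindex_coordSigma (fun i hi => Or.inl (he r hi)) hB
    · exact fun i hi => Or.inr hi

variable [Fintype ι]

/-- If `q` has a unique compatible probability measure, a measure compatible with the split
kernel is the corresponding product measure. -/
lemma LCompatible.eq_map_weave (he : ∀ r, StrictMono (fibreEmb e r))
    (hq : ∀ m g, Measurable[coordSigma G (Set.Iio m)] (q m g)) {ν : Measure (ℤ → G)}
    [IsProbabilityMeasure ν]
    (huniq : ∀ ν', IsProbabilityMeasure ν' ∧ LCompatible q ν' → ν' = ν)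
    {μ : Measure (ℤ → G)} [IsProbabilityMeasure μ] (hμ : LCompatible (splitKernel e q) μ) :
    μ = (Measure.pi fun _ : ι => ν).map (weave G e) := by
  classical
  have hφ : ∀ r, Measurable (reindex G (fibreEmb e r)) := fun r => measurable_reindex _
  have indep : ∀ (r : ι) (E : Set (ℤ → G)), MeasurableSet[coordSigma G {i | (e i).2 ≠ r}] E →
      ∀ B, MeasurableSet B →
        μ (reindex G (fibreEmb e r) ⁻¹' B ∩ E) = ν B * μ E := by
    intro r E hE B hB
    by_cases h0 : μ E = 0
    · rw [h0, mul_zero]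
      exact measure_mono_null Set.inter_subset_right h0
    have hp : IsProbabilityMeasure (ProbabilityTheory.cond μ E) := cond_isProbabilityMeasure h0
    have h := huniq _ ⟨Measure.isProbabilityMeasure_map (hφ r).aemeasurable,
      hμ.map_reindex_cond he hq r hE⟩
    rw [← h, Measure.map_apply (hφ r) hB, cond_mul_eq_inter (coordSigma_le _ _ hE),
      Set.inter_comm]
  have prod : ∀ (B : ι → Set (ℤ → G)), (∀ r, MeasurableSet (B r)) → ∀ R : Finset ι,
      μ (⋂ r ∈ R, reindex G (fibreEmb e r) ⁻¹' B r) = ∏ r ∈ R, ν (B r) := by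
    intro B hB R
    induction R using Finset.induction_on with
    | empty => simp
    | insert r R hr ih =>
      rw [Finset.set_biInter_insert, indep r _ ?_ _ (hB r), ih, Finset.prod_insert hr]
      refine Finset.measurableSet_biInter R fun s hs => ?_
      have hs' : s ≠ r := fun h => hr (h ▸ hs)
      have huniv : coordSigma G Set.univ = MeasurableSpace.pi := by
        simp [coordSigma, MeasurableSpace.pi]
      refine measurable_reindex_coordSigma (T := Set.univ) (fun m _ => ?_) ?_
      · simpa [fibreEmb] using hs'
      · rw [huniv]; exact hB s
  have hpi : Measurable fun (x : ℤ → G) (r : ι) => reindex G (fibreEmb e r) x :=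
    measurable_pi_lambda _ hφ
  have hmap : (Measure.pi fun _ : ι => ν)
      = μ.map fun x r => reindex G (fibreEmb e r) x := by
    refine Measure.pi_eq fun B hB => ?_
    rw [Measure.map_apply hpi (MeasurableSet.univ_pi hB), ← prod B hB Finset.univ]
    congr 1
    ext x
    simp
  rw [hmap, Measure.map_map measurable_weave hpi]
  have : weave G e ∘ (fun x r => reindex G (fibreEmb e r) x) = id := funext weave_reindex
  rw [this, Measure.map_id]

lemma setLIntegral_pi_eval {X : Type*} [MeasurableSpace X] [DecidableEq ι] (ν : Measure X)
    [IsProbabilityMeasure ν] {B : ι → Set X} (hB : ∀ i, MeasurableSet (B i)) (r : ι)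
    {f : X → ℝ≥0∞} (hf : Measurable f) :
    ∫⁻ y in Set.univ.pi B, f (y r) ∂(Measure.pi fun _ : ι => ν)
      = (∫⁻ x in B r, f x ∂ν) * ∏ i ∈ Finset.univ.erase r, ν (B i) := by
  let F : ι → X → ℝ≥0∞ := fun i => (B i).indicator (if i = r then f else 1)
  have hF : ∀ i, Measurable (F i) := fun i => by
    refine Measurable.indicator ?_ (hB i)
    split_ifs
    · exact hf
    · exact measurable_one
  have hind : iIndepFun (fun i (y : ι → X) => F i (y i)) (Measure.pi fun _ : ι => ν) :=
    iIndepFun_pi fun i => (hF i).aemeasurable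
  have h1 := lintegral_prod_eq_prod_lintegral_of_indepFun Finset.univ _ hind
    fun i => (hF i).comp (measurable_pi_apply i)
  have h2 : ∀ i, ∫⁻ y, F i (y i) ∂(Measure.pi fun _ : ι => ν) = ∫⁻ x, F i x ∂ν := fun i =>
    (measurePreserving_eval (fun _ : ι => ν) i).lintegral_comp (hF i)
  have h3 : ∀ y : ι → X, (Set.univ.pi B).indicator (fun y => f (y r)) y = ∏ i, F i (y i) := by
    intro y
    by_cases hy : y ∈ Set.univ.pi B
    · have hy' : ∀ i, y i ∈ B i := by simpa using hy
      rw [Set.indicator_of_mem hy, Finset.prod_eq_single r]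
      · simp [F, hy']
      · intro i _ hi
        simp [F, hi, hy']
      · simp
    · obtain ⟨i, hi⟩ : ∃ i, y i ∉ B i := by simpa using hy
      rw [Set.indicator_of_notMem hy, Finset.prod_eq_zero (Finset.mem_univ i)]
      exact Set.indicator_of_notMem hi _
  rw [← lintegral_indicator (MeasurableSet.univ_pi hB), lintegral_congr h3, h1,
    ← Finset.mul_prod_erase _ _ (Finset.mem_univ r)]
  simp only [h2]
  congr 1
  · simp [F, lintegral_indicator (hB r)]
  · refine Finset.prod_congr rfl fun i hi => ?_
    simp [F, Finset.ne_of_mem_erase hi, lintegral_indicator_one (hB i)]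

/-- The interleaving of independent copies of a compatible measure is compatible with the split
kernel. -/
lemma LCompatible.map_weave (he : ∀ r, StrictMono (fibreEmb e r))
    (hq : ∀ m g, Measurable[coordSigma G (Set.Iio m)] (q m g)) {ν : Measure (ℤ → G)}
    [IsProbabilityMeasure ν] (hν : LCompatible q ν) :
    LCompatible (splitKernel e q) ((Measure.pi fun _ : ι => ν).map (weave G e)) := by
  classical
  intro n g E hE
  have : IsProbabilityMeasure ((Measure.pi fun _ : ι => ν).map (weave G e)) :=
    Measure.isProbabilityMeasure_map measurable_weave.aemeasurable
  refine measure_inter_eq_setLIntegral_of_finCylinder (fun t a ht => ?_) hE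
  set r := (e n).2 with hr
  set m := (e n).1 with hm
  have hqm : Measurable (q m g) := (hq m g).mono (coordSigma_le _) le_rfl
  have hc := coordSigma_le _ _ (measurableSet_finCylinder ht a)
  have hg := measurableSet_apply_eq (G := G) n g
  let T : ι → Finset ℤ := fun s => (t.filter fun i => (e i).2 = s).image fun i => (e i).1
  let B : ι → Set (ℤ → G) := fun s => finCylinder (T s) (reindex G (fibreEmb e s) a)
  have hBpast : MeasurableSet[coordSigma G (Set.Iio m)] (B r) := by
    refine measurableSet_finCylinder (fun k hk => ?_) _
    simp only [T, Finset.coe_image, Finset.coe_filter, Set.mem_image, Set.mem_ofPred_eq] at hk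
    obtain ⟨i, ⟨hit, hir⟩, rfl⟩ := hk
    have hin : i < n := ht hit
    rw [Set.mem_Iio, ← (he r).lt_iff_lt]
    have h1 : fibreEmb e r (e i).1 = i := by rw [← hir]; simp [fibreEmb]
    have h2 : fibreEmb e r m = n := by simp [fibreEmb, hm, hr]
    rwa [h1, h2]
  have hB : ∀ s, MeasurableSet (B s) := fun s =>
    coordSigma_le _ _ (measurableSet_finCylinder (Set.subset_univ _) _)
  have hpre : weave G e ⁻¹' finCylinder t a = Set.univ.pi B := by
    ext y
    simp only [B, T, finCylinder, weave, reindex, fibreEmb, Set.mem_preimage, Set.mem_ofPred_eq,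
      Set.mem_univ_pi, Finset.mem_image, Finset.mem_filter]
    constructor
    · rintro h s k ⟨i, ⟨hit, rfl⟩, rfl⟩
      simpa using h i hit
    · intro h i hi
      simpa using h (e i).2 (e i).1 ⟨i, ⟨hi, rfl⟩, rfl⟩
  have hind : Measurable (({z : ℤ → G | z m = g}).indicator (1 : (ℤ → G) → ℝ≥0∞)) :=
    measurable_one.indicator (measurableSet_apply_eq m g)
  have hL : ∫⁻ y in Set.univ.pi B, ({z : ℤ → G | z m = g}).indicator 1 (y r)
      ∂(Measure.pi fun _ : ι => ν)
      = (Measure.pi fun _ : ι => ν) (weave G e ⁻¹' (finCylinder t a ∩ {x | x n = g})) := by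
    rw [Set.preimage_inter, hpre, Set.inter_comm,
      ← Measure.restrict_apply (measurable_weave hg), ← lintegral_indicator_one
      (measurable_weave hg)]
    rfl
  rw [Measure.map_apply measurable_weave (hc.inter hg), ← hL,
    setLIntegral_pi_eval ν hB r hind,
    setLIntegral_map hc (measurable_splitKernel he hq n g) measurable_weave, hpre]
  simp only [splitKernel, reindex_weave]
  rw [setLIntegral_pi_eval ν hB r hqm, ← hν m g _ hBpast,
    lintegral_indicator_one (measurableSet_apply_eq m g),
    Measure.restrict_apply (measurableSet_apply_eq m g), Set.inter_comm]

theorem existsUnique_lcompatible_splitKernel_iff [Nonempty ι]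
    (he : ∀ r, StrictMono (fibreEmb e r))
    (hq : ∀ m g, Measurable[coordSigma G (Set.Iio m)] (q m g)) :
    (∃! μ : Measure (ℤ → G), IsProbabilityMeasure μ ∧ LCompatible (splitKernel e q) μ) ↔
      ∃! μ : Measure (ℤ → G), IsProbabilityMeasure μ ∧ LCompatible q μ := by
  constructor
  · rintro ⟨μ, ⟨hμp, hμ⟩, huniq⟩
    obtain ⟨r⟩ := ‹Nonempty ι›
    have hφ := measurable_reindex (G := G) (fibreEmb e r)
    refine ⟨μ.map (reindex G (fibreEmb e r)),
      ⟨Measure.isProbabilityMeasure_map hφ.aemeasurable, ?_⟩, ?_⟩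
    · have := hμ.map_reindex_cond he hq r (@MeasurableSet.univ _ (coordSigma G _))
      rwa [cond_univ] at this
    · rintro ν ⟨hνp, hν⟩
      have h := huniq _ ⟨Measure.isProbabilityMeasure_map measurable_weave.aemeasurable,
        hν.map_weave he hq⟩
      rw [← h, Measure.map_map hφ measurable_weave]
      have : reindex G (fibreEmb e r) ∘ weave G e = Function.eval r :=
        funext (reindex_weave r)
      rw [this, (measurePreserving_eval (fun _ : ι => ν) r).map_eq]
  · rintro ⟨ν, ⟨hνp, hν⟩, huniq⟩
    refine ⟨_, ⟨Measure.isProbabilityMeasure_map measurable_weave.aemeasurable,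
      hν.map_weave he hq⟩, ?_⟩
    rintro μ ⟨hμp, hμ⟩
    exact hμ.eq_map_weave he hq huniq

end Splitting

section Imitation

variable {G : Type*}

/-- The imitation kernel with values in `ℝ≥0∞`. -/
noncomputable def imitationKernel (θ : ℕ → ℝ) (P : ℕ → G → G → ℝ) :
    ℤ → G → (ℤ → G) → ℝ≥0∞ :=
  fun n g x => ∑' k : ℕ, ENNReal.ofReal (θ k * P k (x (n - k)) g)

lemma imitationKernel_eq_splitKernel {θ : ℕ → ℝ} {P : ℕ → G → G → ℝ} {d : ℕ} [NeZero d]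
    (hθ : ∀ k, ¬ d ∣ k → θ k = 0) :
    imitationKernel θ P = splitKernel (Int.divModEquiv d)
      (imitationKernel (fun l => θ (l * d)) fun l => P (l * d)) := by
  ext n g x
  have hinj : Function.Injective fun l : ℕ => l * d :=
    mul_left_injective₀ (NeZero.ne d)
  simp only [imitationKernel, splitKernel]
  rw [← hinj.tsum_eq]
  · refine tsum_congr fun l => ?_
    have hx : reindex G (fibreEmb (Int.divModEquiv d) ((Int.divModEquiv d) n).2) x
        ((Int.divModEquiv d n).1 - l) = x (n - ((l * d : ℕ) : ℤ)) := by
      have hn := (Int.divModEquiv d).symm_apply_apply n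
      simp only [Int.divModEquiv_symm_apply] at hn
      simp only [reindex, fibreEmb, Int.divModEquiv_symm_apply]
      congr 1
      push_cast
      linarith
    rw [hx]
  · intro k hk
    by_contra hnot
    refine hk ?_
    have : ¬ d ∣ k := fun ⟨l, hl⟩ => hnot ⟨l, by simp [hl, mul_comm]⟩
    simp [hθ k this]

variable [MeasurableSpace G] [Finite G] [MeasurableSingletonClass G]

lemma measurable_imitationKernel {θ : ℕ → ℝ} (P : ℕ → G → G → ℝ) (hθ : θ 0 = 0)
    (n : ℤ) (g : G) :
    Measurable[coordSigma G (Set.Iio n)] (imitationKernel θ P n g) := by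
  refine @Measurable.tsum _ _ _ (coordSigma G (Set.Iio n)) _ _ _ _ _ _ _ _ _ _ _ _ fun k => ?_
  rcases Nat.eq_zero_or_pos k with rfl | hk
  · simp [hθ]
  · have h : Measurable fun i : G => ENNReal.ofReal (θ k * P k i g) := measurable_of_finite _
    exact h.comp (measurable_apply_coordSigma (show n - (k : ℤ) < n by omega))

lemma compatible_iff_lcompatible {θ : ℕ → ℝ} {P : ℕ → G → G → ℝ} (hθ : θ 0 = 0)
    (hsum : Summable θ) (h0 : ∀ k i j, 0 ≤ θ k * P k i j) (h1 : ∀ k i j, θ k * P k i j ≤ θ k)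
    (μ : Measure (ℤ → G)) [IsProbabilityMeasure μ] :
    Compatible θ P μ ↔ LCompatible (imitationKernel θ P) μ := by
  refine forall_congr' fun n => forall_congr' fun g => forall_congr' fun E => ?_
  rw [pastMeasurable_iff]
  refine imp_congr_right fun hE => ?_
  have hs : ∀ x : ℤ → G, Summable fun k : ℕ => θ k * P k (x (n - k)) g := fun x =>
    Summable.of_nonneg_of_le (fun k => h0 _ _ _) (fun k => h1 _ _ _) hsum
  have hof : ∀ x : ℤ → G, ENNReal.ofReal (∑' k : ℕ, θ k * P k (x (n - k)) g)
      = imitationKernel θ P n g x := fun x =>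
    ENNReal.ofReal_tsum_of_nonneg (fun k => h0 _ _ _) (hs x)
  have hmeas : Measurable (imitationKernel θ P n g) :=
    (measurable_imitationKernel P hθ n g).mono (coordSigma_le _) le_rfl
  have hre : (fun x : ℤ → G => ∑' k : ℕ, θ k * P k (x (n - k)) g)
      = fun x => (imitationKernel θ P n g x).toReal := by
    ext x
    rw [← hof, ENNReal.toReal_ofReal (tsum_nonneg fun k => h0 _ _ _)]
  have hle : ∀ x, imitationKernel θ P n g x ≤ ENNReal.ofReal (∑' k, θ k) := fun x => by
    rw [← hof]
    exact ENNReal.ofReal_le_ofReal ((hs x).tsum_le_tsum (fun k => h1 _ _ _) hsum)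
  have hfin : ∫⁻ x in E, imitationKernel θ P n g x ∂μ ≠ ∞ := by
    refine ne_top_of_le_ne_top ?_ (lintegral_mono hle)
    rw [lintegral_const]
    exact ENNReal.mul_ne_top ENNReal.ofReal_ne_top (measure_ne_top _ _)
  rw [hre, integral_toReal hmeas.aemeasurable
    (Filter.Eventually.of_forall fun x => (hle x).trans_lt ENNReal.ofReal_lt_top),
    ENNReal.toReal_eq_toReal_iff' (measure_ne_top _ _) hfin]

end Imitation

end ImitationUniqueness

/-- for `d = gcd(A) > 1`, uniqueness for `p` holds iff uniqueness
holds for the rescaled kernel `p̄` built from `Ā = {l : l·d ∈ A}`,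
`θ̄_l = θ_{l·d}` and `P̄_(l) = P_(l·d)`. -/
theorem stmt_4 {G : Type*} [Fintype G] [DecidableEq G] [Nonempty G]
    [MeasurableSpace G] [MeasurableSingletonClass G]
    (A : Set ℕ) (hA : A.Nonempty) (hApos : ∀ k ∈ A, 0 < k)
    (θ : ℕ → ℝ) (hθpos : ∀ k ∈ A, 0 < θ k) (hθ0 : ∀ k, k ∉ A → θ k = 0)
    (hθsum : HasSum θ 1)
    (P : ℕ → G → G → ℝ)
    (hPnn : ∀ k ∈ A, ∀ i j : G, 0 ≤ P k i j)
    (hProw : ∀ k ∈ A, ∀ i : G, ∑ j, P k i j = 1)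
    (d : ℕ) (hgcd : IsGCDOfSet A d) (hd : 1 < d) :
    (∃! μ : Measure (ℤ → G), IsProbabilityMeasure μ ∧ Compatible θ P μ) ↔
      (∃! μ : Measure (ℤ → G), IsProbabilityMeasure μ ∧
        Compatible (fun l => θ (l * d)) (fun l => P (l * d)) μ) := by
  have hd0 : NeZero d := ⟨by omega⟩
  have h00 : θ 0 = 0 := hθ0 0 fun h => lt_irrefl 0 (hApos 0 h)
  have h0 : ∀ k i j, 0 ≤ θ k * P k i j := fun k i j => by
    by_cases hk : k ∈ A
    · exact mul_nonneg (hθpos k hk).le (hPnn k hk i j)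
    · simp [hθ0 k hk]
  have h1 : ∀ k i j, θ k * P k i j ≤ θ k := fun k i j => by
    by_cases hk : k ∈ A
    · refine mul_le_of_le_one_right (hθpos k hk).le ?_
      rw [← hProw k hk i]
      exact Finset.single_le_sum (fun j _ => hPnn k hk i j) (Finset.mem_univ j)
    · simp [hθ0 k hk]
  have hdvd : ∀ k, ¬ d ∣ k → θ k = 0 := fun k hk => hθ0 k fun h => hk (hgcd.1 k h)
  have h00' : θ (0 * d) = 0 := by simp [h00]
  have hinj : Function.Injective fun l : ℕ => l * d := mul_left_injective₀ (NeZero.ne d)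
  have he : ∀ r, StrictMono (fibreEmb (Int.divModEquiv d) r) := fun r a b hab => by
    have hdpos : (0 : ℤ) < d := by omega
    simp only [fibreEmb, Int.divModEquiv_symm_apply]
    nlinarith
  have key := existsUnique_lcompatible_splitKernel_iff he
    (measurable_imitationKernel (G := G) (θ := fun l => θ (l * d)) (fun l => P (l * d)) h00')
  rw [← imitationKernel_eq_splitKernel hdvd] at key
  have hl : ∀ μ : Measure (ℤ → G), (IsProbabilityMeasure μ ∧ Compatible θ P μ) ↔
      (IsProbabilityMeasure μ ∧ LCompatible (imitationKernel θ P) μ) := fun μ =>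
    and_congr_right fun _ => compatible_iff_lcompatible h00 hθsum.summable h0 h1 μ
  have hr : ∀ μ : Measure (ℤ → G),
      (IsProbabilityMeasure μ ∧ Compatible (fun l => θ (l * d)) (fun l => P (l * d)) μ) ↔
      (IsProbabilityMeasure μ ∧
        LCompatible (imitationKernel (fun l => θ (l * d)) fun l => P (l * d)) μ) := fun μ =>
    and_congr_right fun _ => compatible_iff_lcompatible (θ := fun l => θ (l * d)) h00'
      (hθsum.summable.comp_injective hinj) (fun k => h0 _) (fun k => h1 _) μ
  simp only [hl, hr]
  exact key
end
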